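/- arXiv:2404.01550 — 5 statements merged into one kernel-verified Lean document; each statement's English description precedes it below -/
import Mathlib

section
/- Let A ∈ ℝ^{n_x×n_x}, B ∈ ℝ^{n_x×n_u}, C ∈ ℝ^{n_y×n_x}, B̄ ∈ ℝ^{n_x×n_y}, C̄ ∈ ℝ^{n_y×n_y}, L_x ∈ ℝ^{n_x×n_y}, L_d ∈ ℝ^{n_y N×n_y}. Suppose the sequences x̂ : ℤ_{≥0} → ℝ^{n_x}, d̂ : ℤ_{≥0} → ℝ^{n_y N}, u : ℤ_{≥0} → ℝ^{n_u}, y^f : ℤ_{≥0} → ℝ^{n_y} are all N-periodic and satisfy the observer recursion x̂(t+1) = A x̂(t) + B̄ S_sel d̂(t) + B u(t) + L_x e(t) and d̂(t+1) = S_d d̂(t) + L_d e(t), where e(t) := −y^f(t) + C x̂(t) + C̄ S_sel d̂(t). If the n_y N × n_y N matrix [S_d^{N−1} L_d, S_d^{N−2} L_d, …, S_d L_d, L_d] is invertible, then e(t) = 0 for all t, and for all t the stacked vectors 𝐱̂(t) := (x̂(t), x̂(t+1), …, x̂(t+N−1)), 𝐮(t) := (u(t),…,u(t+N−1)), 𝐲^f(t)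 := (y^f(t),…,y^f(t+N−1)) satisfy (A_N − S_x) 𝐱̂(t) + B_N 𝐮(t) = −B̄_N 𝐝̂(t) and C_N 𝐱̂(t) = 𝐲^f(t) − C̄_N 𝐝̂(t), where 𝐝̂(t) := (S_sel d̂(t), S_sel S_d d̂(t) S_sel-shifted appropriately, …) is the stacked disturbance sequence (S_sel S_d^k d̂(t))_{k=0}^{N−1}. -/
open Matrix Kronecker

/-- The `N × N` cyclic forward shift matrix: ones on the first superdiagonal
and a one in the bottom-left corner. -/
def cyclicShift (R : Type*) [Zero R] [One R] (N : ℕ) : Matrix (Fin N) (Fin N) R :=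
  Matrix.of fun i j => if (j : ℕ) = ((i : ℕ) + 1) % N then 1 else 0

/-- The selection matrix `S_sel = [I, 0, …, 0]` picking the first `n_y` block. -/
def selMat (R : Type*) [Zero R] [One R] (N ny : ℕ) : Matrix (Fin ny) (Fin N × Fin ny) R :=
  Matrix.of fun i p => if (p.1 : ℕ) = 0 ∧ p.2 = i then 1 else 0

/-- `S_d = S ⊗ I_{n_y}`. -/
def Sdmat (N ny : ℕ) : Matrix (Fin N × Fin ny) (Fin N × Fin ny) ℝ :=
  cyclicShift ℝ N ⊗ₖ (1 : Matrix (Fin ny) (Fin ny) ℝ)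

/-- The stacked vector `(v(t), v(t+1), …, v(t+N-1))`. -/
def stackSeq (N n : ℕ) (v : ℕ → Fin n → ℝ) (t : ℕ) : Fin N × Fin n → ℝ :=
  fun p => v (t + (p.1 : ℕ)) p.2

/-- The stacked disturbance sequence `(S_sel S_d^k d̂(t))_{k=0}^{N-1}`. -/
def stackDist (N ny : ℕ) (dhat : ℕ → Fin N × Fin ny → ℝ) (t : ℕ) : Fin N × Fin ny → ℝ :=
  fun p => (selMat ℝ N ny).mulVec (((Sdmat N ny) ^ (p.1 : ℕ)).mulVec (dhat t)) p.2

theorem cyclicShift_kronecker_one_mulVec {N n : ℕ} (v : Fin N × Fin n → ℝ) (i : Fin N)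
    (k : Fin n) :
    (cyclicShift ℝ N ⊗ₖ (1 : Matrix (Fin n) (Fin n) ℝ)).mulVec v (i, k)
      = v (⟨((i : ℕ) + 1) % N, Nat.mod_lt _ i.pos⟩, k) := by
  rw [mulVec, dotProduct, Finset.sum_eq_single (⟨((i : ℕ) + 1) % N, Nat.mod_lt _ i.pos⟩, k)]
  · simp [cyclicShift]
  · rintro ⟨j, l⟩ - h
    by_cases hl : k = l
    · subst hl
      have hj : (j : ℕ) ≠ ((i : ℕ) + 1) % N := fun hj => h (by ext <;> simp [hj])
      simp [cyclicShift, hj]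
    · simp [one_apply_ne hl]
  · simp

theorem one_kronecker_mulVec {N m n : ℕ} (M : Matrix (Fin m) (Fin n) ℝ)
    (v : Fin N × Fin n → ℝ) (i : Fin N) (k : Fin m) :
    ((1 : Matrix (Fin N) (Fin N) ℝ) ⊗ₖ M).mulVec v (i, k)
      = M.mulVec (fun j => v (i, j)) k := by
  simp [mulVec, dotProduct, Fintype.sum_prod_type, one_apply, Finset.sum_ite_eq]

theorem Sdmat_pow_mulVec {N n : ℕ} (m : ℕ) (v : Fin N × Fin n → ℝ) (i : Fin N) (k : Fin n) :
    ((Sdmat N n) ^ m).mulVec v (i, k) = v (⟨((i : ℕ) + m) % N, Nat.mod_lt _ i.pos⟩, k) := by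
  induction m generalizing v with
  | zero => simp [Nat.mod_eq_of_lt i.isLt]
  | succ m ih =>
    rw [pow_succ, ← mulVec_mulVec, ih, Sdmat, cyclicShift_kronecker_one_mulVec]
    simp [Nat.add_assoc]

theorem Sdmat_pow_self (N n : ℕ) : (Sdmat N n) ^ N = 1 := by
  refine mulVec_injective (funext fun v => funext fun ⟨i, k⟩ => ?_)
  simp [Sdmat_pow_mulVec, Nat.mod_eq_of_lt i.isLt]

/-- Variation of constants for a discrete-time linear recursion. -/
theorem mulVec_recursion_add {ι κ : Type*} [Fintype ι] [DecidableEq ι] [Fintype κ]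
    (S : Matrix ι ι ℝ) (L : Matrix ι κ ℝ) (d : ℕ → ι → ℝ) (e : ℕ → κ → ℝ)
    (h : ∀ t, d (t + 1) = S.mulVec (d t) + L.mulVec (e t)) (t m : ℕ) :
    d (t + m) = (S ^ m).mulVec (d t)
      + ∑ j ∈ Finset.range m, (S ^ (m - 1 - j) * L).mulVec (e (t + j)) := by
  induction m with
  | zero => simp
  | succ m ih =>
    rw [← Nat.add_assoc, h, ih, Finset.sum_range_succ, mulVec_add, mulVec_mulVec, ← pow_succ',
      mulVec_sum, add_assoc]
    congr 2
    · refine Finset.sum_congr rfl fun j hj => ?_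
      have hj := Finset.mem_range.mp hj
      rw [mulVec_mulVec, ← Matrix.mul_assoc, ← pow_succ']
      congr 3
      omega
    · simp

/-- for `N`-periodic signals satisfying the observer recursion, if the
matrix `[S_d^{N-1} L_d, …, S_d L_d, L_d]` is invertible, the innovation `e` vanishes
identically and the stacked periodic trajectories satisfy the steady-state relations. -/
theorem stmt3 (N nx ny nu : ℕ) (hN : 0 < N) (hnx : 0 < nx) (hny : 0 < ny) (hnu : 0 < nu)
    (A : Matrix (Fin nx) (Fin nx) ℝ) (B : Matrix (Fin nx) (Fin nu) ℝ)
    (C : Matrix (Fin ny) (Fin nx) ℝ)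
    (Bbar : Matrix (Fin nx) (Fin ny) ℝ) (Cbar : Matrix (Fin ny) (Fin ny) ℝ)
    (Lx : Matrix (Fin nx) (Fin ny) ℝ) (Ld : Matrix (Fin N × Fin ny) (Fin ny) ℝ)
    (xhat : ℕ → Fin nx → ℝ) (dhat : ℕ → Fin N × Fin ny → ℝ)
    (u : ℕ → Fin nu → ℝ) (yf : ℕ → Fin ny → ℝ)
    (e : ℕ → Fin ny → ℝ)
    (he : ∀ t, e t = -yf t + C.mulVec (xhat t) + (Cbar * selMat ℝ N ny).mulVec (dhat t))
    -- all sequences are N-periodic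
    (hxper : ∀ t, xhat (t + N) = xhat t) (hdper : ∀ t, dhat (t + N) = dhat t)
    (huper : ∀ t, u (t + N) = u t) (hyper : ∀ t, yf (t + N) = yf t)
    -- observer recursion
    (hxrec : ∀ t, xhat (t + 1) =
      A.mulVec (xhat t) + (Bbar * selMat ℝ N ny).mulVec (dhat t) + B.mulVec (u t)
        + Lx.mulVec (e t))
    (hdrec : ∀ t, dhat (t + 1) = (Sdmat N ny).mulVec (dhat t) + Ld.mulVec (e t))
    -- invertibility of [S_d^{N-1} L_d, …, S_d L_d, L_d]
    (hinv : IsUnit (Matrix.of fun (p : Fin N × Fin ny) (q : Fin N × Fin ny) =>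
      ((Sdmat N ny) ^ (N - 1 - (q.1 : ℕ)) * Ld) p q.2)) :
    (∀ t, e t = 0) ∧
    (∀ t,
      ((1 : Matrix (Fin N) (Fin N) ℝ) ⊗ₖ A
          - cyclicShift ℝ N ⊗ₖ (1 : Matrix (Fin nx) (Fin nx) ℝ)).mulVec
          (stackSeq N nx xhat t)
        + ((1 : Matrix (Fin N) (Fin N) ℝ) ⊗ₖ B).mulVec (stackSeq N nu u t)
      = -((1 : Matrix (Fin N) (Fin N) ℝ) ⊗ₖ Bbar).mulVec (stackDist N ny dhat t)) ∧
    (∀ t,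
      ((1 : Matrix (Fin N) (Fin N) ℝ) ⊗ₖ C).mulVec (stackSeq N nx xhat t)
      = stackSeq N ny yf t
        - ((1 : Matrix (Fin N) (Fin N) ℝ) ⊗ₖ Cbar).mulVec (stackDist N ny dhat t)) := by
  have he0 : ∀ t, e t = 0 := by
    intro t
    have hsum := mulVec_recursion_add _ _ _ _ hdrec t N
    rw [hdper, Sdmat_pow_self, one_mulVec, left_eq_add] at hsum
    have hmul : (Matrix.of fun (p : Fin N × Fin ny) (q : Fin N × Fin ny) =>
        ((Sdmat N ny) ^ (N - 1 - (q.1 : ℕ)) * Ld) p q.2).mulVec (stackSeq N ny e t) = 0 := by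
      rw [← hsum, ← Fin.sum_univ_eq_sum_range
        fun j => (Sdmat N ny ^ (N - 1 - j) * Ld).mulVec (e (t + j))]
      ext p
      simp [mulVec, dotProduct, Fintype.sum_prod_type, stackSeq]
    have hstack : stackSeq N ny e t = 0 :=
      mulVec_injective_of_isUnit hinv (hmul.trans (mulVec_zero _).symm)
    ext k
    simpa [stackSeq] using congrFun hstack (⟨0, hN⟩, k)
  have hdist : ∀ t (i : Fin N), (fun k => stackDist N ny dhat t (i, k))
      = (selMat ℝ N ny).mulVec (dhat (t + i)) := by
    intro t i
    rw [mulVec_recursion_add _ _ _ _ hdrec t i]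
    simp [he0, stackDist]
  have hxmod : ∀ t i, xhat (t + i % N) = xhat (t + i) := fun t i =>
    Function.Periodic.map_mod_nat (f := fun j => xhat (t + j))
      (fun j => by simp [← Nat.add_assoc, hxper]) i
  refine ⟨he0, fun t => ?_, fun t => ?_⟩
  · ext ⟨i, k⟩
    have hx := congrFun (hxrec (t + i)) k
    simp only [he0, mulVec_zero, ← mulVec_mulVec, Pi.add_apply, Pi.zero_apply, add_zero] at hx
    simp only [sub_mulVec, Pi.add_apply, Pi.sub_apply, Pi.neg_apply,
      one_kronecker_mulVec, cyclicShift_kronecker_one_mulVec, hdist]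
    simp only [stackSeq, hxmod, ← Nat.add_assoc, hx]
    ring
  · ext ⟨i, k⟩
    have hy := congrFun (he (t + i)) k
    simp only [he0, ← mulVec_mulVec, Pi.add_apply, Pi.neg_apply, Pi.zero_apply] at hy
    simp only [Pi.sub_apply, one_kronecker_mulVec, hdist]
    simp only [stackSeq]
    linarith
end

section
/- Consider the observer for the augmented periodic-disturbance system: with F := [[A + L_x C, (B̄ + L_x C̄) S_sel], [L_d C, S_d + L_d C̄ S_sel]] ∈ ℝ^{(n_x+n_y N)×(n_x+n_y N)}, the estimates evolve as (x̂(t+1), d̂(t+1)) = F (x̂(t), d̂(t)) + (B u(t), 0) − (L_x, L_d) y^f(t). Suppose F has spectral radius strictly less than 1, and the input and output sequences u, y^f are asymptotically N-periodic, i.e., ‖u(t+N) − u(t)‖ → 0 and ‖y^f(t+N) − y^f(t)‖ → 0 as t → ∞. Then ‖x̂(t+N) − x̂(t)‖ → 0 and ‖d̂(t+N) − d̂(t)‖ → 0 as t → ∞, i.e., the estimator converges to an N-periodic trajectory. -/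
open Matrix Kronecker Filter

open scoped Topology ENNReal

/-- In a complex Banach algebra, the powers of an element whose spectrum lies in the open unit
disc are absolutely summable. -/
theorem summable_norm_pow_of_spectrum_norm_lt_one {R : Type*} [NormedRing R] [NormedAlgebra ℂ R]
    [CompleteSpace R] [Nontrivial R] {a : R} (ha : ∀ z ∈ spectrum ℂ a, ‖z‖ < 1) :
    Summable fun n : ℕ => ‖a ^ n‖ := by
  have hrad : spectralRadius ℂ a < ((1 : NNReal) : ℝ≥0∞) :=
    spectrum.spectralRadius_lt_of_forall_lt a fun z hz => ha z hz
  obtain ⟨r, har, hr⟩ := ENNReal.lt_iff_exists_nnreal_btwn.1 hrad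
  have hr' : (r : ℝ) < 1 := by exact_mod_cast hr
  have hev := (spectrum.pow_nnnorm_pow_one_div_tendsto_nhds_spectralRadius a).eventually_lt_const
    har
  refine Summable.of_norm_bounded_eventually_nat (summable_geometric_of_lt_one r.2 hr') ?_
  filter_upwards [hev, eventually_gt_atTop 0] with n hn hpos
  have h := ENNReal.rpow_le_rpow hn.le (Nat.cast_nonneg n : (0 : ℝ) ≤ n)
  rw [← ENNReal.rpow_mul, one_div_mul_cancel (by positivity), ENNReal.rpow_one,
    ENNReal.rpow_natCast] at h
  rw [norm_norm]
  exact_mod_cast h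

/-- The convolution of a summable sequence with a null sequence is a null sequence. -/
theorem tendsto_sum_range_mul_sub_of_summable {b w : ℕ → ℝ} (hb : Summable b) (hb0 : ∀ k, 0 ≤ b k)
    (hw : Tendsto w atTop (𝓝 0)) :
    Tendsto (fun t => ∑ k ∈ Finset.range t, b k * w (t - 1 - k)) atTop (𝓝 0) := by
  obtain ⟨W, hW⟩ := hw.norm.bddAbove_range
  have hW' : ∀ n, ‖w n‖ ≤ W := fun n => hW ⟨n, rfl⟩
  have key := tendsto_tsum_of_dominated_convergence (𝓕 := atTop)
    (f := fun (t k : ℕ) => if k < t then b k * w (t - 1 - k) else 0) (g := fun _ => 0)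
    (hb.mul_right W) ?_ ?_
  · rw [tsum_zero] at key
    refine key.congr fun t => ?_
    rw [tsum_eq_sum (s := Finset.range t) fun k hk => if_neg (by simpa using hk)]
    exact Finset.sum_congr rfl fun k hk => if_pos (Finset.mem_range.1 hk)
  · intro k
    have hshift : Tendsto (fun t => t - 1 - k) atTop atTop :=
      (tendsto_sub_atTop_nat k).comp (tendsto_sub_atTop_nat 1)
    have h := (hw.comp hshift).const_mul (b k)
    rw [mul_zero] at h
    refine h.congr' ?_
    filter_upwards [eventually_gt_atTop k] with t ht
    simp [ht]
  · refine Eventually.of_forall fun t k => ?_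
    split_ifs
    · rw [norm_mul, Real.norm_of_nonneg (hb0 k)]
      exact mul_le_mul_of_nonneg_left (hW' _) (hb0 k)
    · rw [norm_zero]
      exact mul_nonneg (hb0 k) ((norm_nonneg _).trans (hW' 0))

/-- Variation of constants for an affine matrix recursion. -/
theorem eq_pow_mulVec_add_sum_of_recursion {n R : Type*} [Fintype n] [DecidableEq n]
    [CommRing R] {M : Matrix n n R} {e w : ℕ → n → R} (he : ∀ t, e (t + 1) = M *ᵥ e t + w t)
    (t : ℕ) :
    e t = (M ^ t) *ᵥ e 0 + ∑ k ∈ Finset.range t, (M ^ k) *ᵥ w (t - 1 - k) := by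
  induction t with
  | zero => simp
  | succ t ih =>
    rw [he, Finset.sum_range_succ', ih, mulVec_add, mulVec_mulVec, ← pow_succ', mulVec_sum,
      add_assoc]
    congr 2
    · refine Finset.sum_congr rfl fun k _ => ?_
      rw [mulVec_mulVec, ← pow_succ']
      congr 2
      omega
    · simp

attribute [local instance] Matrix.linftyOpNormedRing Matrix.linftyOpNormedAlgebra in
/-- A Schur stable linear recursion driven by a null sequence has null trajectories. -/
theorem tendsto_zero_of_schur_stable_recursion {n : Type*} [Fintype n] [DecidableEq n] [Nonempty n]
    {M : Matrix n n ℂ} (hM : ∀ z ∈ spectrum ℂ M, ‖z‖ < 1) {e w : ℕ → n → ℂ}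
    (he : ∀ t, e (t + 1) = M *ᵥ e t + w t) (hw : Tendsto w atTop (𝓝 0)) :
    Tendsto e atTop (𝓝 0) := by
  have hsum : Summable fun k : ℕ => ‖M ^ k‖ := summable_norm_pow_of_spectrum_norm_lt_one hM
  have hbound := (hsum.tendsto_atTop_zero.mul_const ‖e 0‖).add
    (tendsto_sum_range_mul_sub_of_summable hsum (fun _ => norm_nonneg _)
      (tendsto_zero_iff_norm_tendsto_zero.1 hw))
  rw [zero_mul, zero_add] at hbound
  refine squeeze_zero_norm (fun t => ?_) hbound
  rw [eq_pow_mulVec_add_sum_of_recursion he t]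
  exact (norm_add_le _ _).trans (add_le_add (linfty_opNorm_mulVec _ _)
    (norm_sum_le_of_le _ fun k _ => linfty_opNorm_mulVec _ _))

/-- Version of `tendsto_zero_of_schur_stable_recursion` for real systems. -/
theorem tendsto_zero_of_schur_stable_recursion_real {n : Type*} [Fintype n] [DecidableEq n]
    [Nonempty n] {M : Matrix n n ℝ} (hM : ∀ z ∈ spectrum ℂ (M.map Complex.ofReal), ‖z‖ < 1)
    {e w : ℕ → n → ℝ} (he : ∀ t, e (t + 1) = M *ᵥ e t + w t) (hw : Tendsto w atTop (𝓝 0)) :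
    Tendsto e atTop (𝓝 0) := by
  have h := tendsto_zero_of_schur_stable_recursion hM (e := fun t i => (e t i : ℂ))
    (w := fun t i => (w t i : ℂ)) ?_ ?_
  · rw [tendsto_pi_nhds] at h ⊢
    intro i
    have hi := (Complex.continuous_re.tendsto _).comp (h i)
    simpa [Function.comp_def] using hi
  · intro t
    ext i
    simp [he, mulVec, dotProduct]
  · rw [tendsto_pi_nhds] at hw ⊢
    intro i
    have hi := (Complex.continuous_ofReal.tendsto _).comp (hw i)
    simpa [Function.comp_def] using hi

/-- A fixed matrix maps null sequences of vectors to null sequences. -/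
theorem tendsto_mulVec_zero {m n : Type*} [Fintype n] (M : Matrix m n ℝ) {v : ℕ → n → ℝ}
    (hv : Tendsto v atTop (𝓝 0)) : Tendsto (fun t => M *ᵥ v t) atTop (𝓝 0) := by
  have h := ((Continuous.matrix_mulVec (continuous_const (y := M)) continuous_id).tendsto 0).comp hv
  simpa [Function.comp_def] using h

/-- if the observer closed-loop matrix `F` is Schur stable and the input and
output are asymptotically `N`-periodic, then the estimates `x̂, d̂` are asymptotically
`N`-periodic as well. -/
theorem stmt5 (N nx ny nu : ℕ) (hN : 0 < N) (hnx : 0 < nx) (hny : 0 < ny) (hnu : 0 < nu)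
    (A : Matrix (Fin nx) (Fin nx) ℝ) (B : Matrix (Fin nx) (Fin nu) ℝ)
    (C : Matrix (Fin ny) (Fin nx) ℝ)
    (Bbar : Matrix (Fin nx) (Fin ny) ℝ) (Cbar : Matrix (Fin ny) (Fin ny) ℝ)
    (Lx : Matrix (Fin nx) (Fin ny) ℝ) (Ld : Matrix (Fin N × Fin ny) (Fin ny) ℝ)
    (F : Matrix (Fin nx ⊕ (Fin N × Fin ny)) (Fin nx ⊕ (Fin N × Fin ny)) ℝ)
    (hFdef : F = Matrix.fromBlocks
      (A + Lx * C) ((Bbar + Lx * Cbar) * selMat ℝ N ny)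
      (Ld * C)
      (cyclicShift ℝ N ⊗ₖ (1 : Matrix (Fin ny) (Fin ny) ℝ) + Ld * Cbar * selMat ℝ N ny))
    -- F is Schur stable
    (hF : ∀ mu : ℂ, mu ∈ spectrum ℂ (F.map Complex.ofReal) → ‖mu‖ < 1)
    (xhat : ℕ → Fin nx → ℝ) (dhat : ℕ → Fin N × Fin ny → ℝ)
    (u : ℕ → Fin nu → ℝ) (yf : ℕ → Fin ny → ℝ)
    -- observer recursion: (x̂(t+1), d̂(t+1)) = F (x̂(t), d̂(t)) + (B u(t), 0) - (L_x, L_d) y^f(t)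
    (hrec : ∀ t, Sum.elim (xhat (t + 1)) (dhat (t + 1)) =
      F.mulVec (Sum.elim (xhat t) (dhat t))
        + Sum.elim (B.mulVec (u t)) 0
        - Sum.elim (Lx.mulVec (yf t)) (Ld.mulVec (yf t)))
    -- u and y^f are asymptotically N-periodic
    (hu : Tendsto (fun t => ‖u (t + N) - u t‖) atTop (nhds 0))
    (hy : Tendsto (fun t => ‖yf (t + N) - yf t‖) atTop (nhds 0)) :
    Tendsto (fun t => ‖xhat (t + N) - xhat t‖) atTop (nhds 0) ∧
    Tendsto (fun t => ‖dhat (t + N) - dhat t‖) atTop (nhds 0) := by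
  have : Nonempty (Fin nx) := ⟨⟨0, hnx⟩⟩
  have hu' := tendsto_zero_iff_norm_tendsto_zero.2 hu
  have hy' := tendsto_zero_iff_norm_tendsto_zero.2 hy
  have hw : Tendsto (fun t => (Sum.elim (B *ᵥ (u (t + N) - u t)) 0
      - Sum.elim (Lx *ᵥ (yf (t + N) - yf t)) (Ld *ᵥ (yf (t + N) - yf t)) :
        Fin nx ⊕ (Fin N × Fin ny) → ℝ)) atTop (nhds 0) := by
    have hB := tendsto_pi_nhds.1 (tendsto_mulVec_zero B hu')
    have hLx := tendsto_pi_nhds.1 (tendsto_mulVec_zero Lx hy')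
    have hLd := tendsto_pi_nhds.1 (tendsto_mulVec_zero Ld hy')
    rw [tendsto_pi_nhds]
    rintro (i | i)
    · simpa using (hB i).sub (hLx i)
    · simpa using (hLd i).neg
  have h := tendsto_zero_of_schur_stable_recursion_real hF
    (e := fun t => Sum.elim (xhat (t + N)) (dhat (t + N)) - Sum.elim (xhat t) (dhat t))
    (fun t => ?_) hw
  · rw [tendsto_pi_nhds] at h
    constructor
    · refine tendsto_zero_iff_norm_tendsto_zero.1 (tendsto_pi_nhds.2 fun i => ?_)
      simpa using h (Sum.inl i)
    · refine tendsto_zero_iff_norm_tendsto_zero.1 (tendsto_pi_nhds.2 fun i => ?_)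
      simpa using h (Sum.inr i)
  · have hN' := hrec (t + N)
    rw [add_right_comm] at hN'
    rw [hN', hrec t, mulVec_sub]
    ext (i | i) <;> simp [mulVec_sub] <;> ring
end

section
/- Let A ∈ ℝ^{n_x×n_x}, B ∈ ℝ^{n_x×n_u}, C ∈ ℝ^{n_y×n_x}, H ∈ ℝ^{n_r×n_y}, B̄ ∈ ℝ^{n_x×n_y}, C̄ ∈ ℝ^{n_y×n_y}, and K ∈ ℝ^{n_u×n_x} with A + BK having spectral radius strictly less than 1. Suppose the stacked vectors 𝐱̂ ∈ ℝ^{N n_x}, 𝐮 ∈ ℝ^{N n_u}, 𝐲^f ∈ ℝ^{N n_y}, 𝐝̂ ∈ ℝ^{N n_y}, 𝐫 ∈ ℝ^{N n_r}, 𝐱̄ ∈ ℝ^{N n_x}, 𝐮̄ ∈ ℝ^{N n_u} satisfy: (i) (A_N − S_x) 𝐱̂ + B_N 𝐮 = −B̄_N 𝐝̂ and C_N 𝐱̂ = 𝐲^f − C̄_N 𝐝̂ (observer steady state); (ii) (A_N − S_x) 𝐱̄ + B_N 𝐮̄ = −B̄_N 𝐝̂ and H_N C_N 𝐱̄ = 𝐫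 − H_N C̄_N 𝐝̂ (target equations); (iii) 𝐮 − 𝐮̄ = (I_N ⊗ K)(𝐱̂ − 𝐱̄) (LQR feedback). Then 𝐱̂ = 𝐱̄ and H_N 𝐲^f = 𝐫, i.e., the tracking error of the controlled variable is zero. -/
open Matrix Kronecker

/-- The block-diagonal matrix `I ⊗ M` acts blockwise. -/
theorem one_kronecker_mulVec_apply {ι m n R : Type*} [Fintype ι] [DecidableEq ι] [Fintype n]
    [CommSemiring R] (M : Matrix m n R) (v : ι × n → R) (i : ι) (a : m) :
    (((1 : Matrix ι ι R) ⊗ₖ M) *ᵥ v) (i, a) = (M *ᵥ fun b => v (i, b)) a := by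
  simp [mulVec, dotProduct, Fintype.sum_prod_type, one_apply, ite_mul, Finset.sum_ite_irrel]

/-- The stacked cyclic shift `S ⊗ I` moves every block one step forward. -/
theorem cyclicShift_kronecker_one_mulVec_apply {n R : Type*} [Fintype n] [DecidableEq n]
    [CommSemiring R] {N : ℕ} (v : Fin N × n → R) (i : Fin N) (a : n) :
    ((cyclicShift R N ⊗ₖ (1 : Matrix n n R)) *ᵥ v) (i, a)
      = v (⟨(i + 1) % N, Nat.mod_lt _ i.pos⟩, a) := by
  have h : ∀ j : Fin N, ((j : ℕ) = (i + 1) % N) ↔ j = ⟨(i + 1) % N, Nat.mod_lt _ i.pos⟩ :=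
    fun j => by rw [Fin.ext_iff]
  simp [mulVec, dotProduct, Fintype.sum_prod_type, one_apply, cyclicShift, h, ite_mul]

/-- A real matrix whose complex eigenvalues lie in the open unit disc has no nonzero
periodic vector. -/
theorem eq_zero_of_pow_mulVec_eq_self {n : Type*} [Fintype n] [DecidableEq n]
    {M : Matrix n n ℝ} (hM : ∀ μ ∈ spectrum ℂ (M.map Complex.ofReal), ‖μ‖ < 1)
    {k : ℕ} (hk : 0 < k) {v : n → ℝ} (hv : (M ^ k) *ᵥ v = v) : v = 0 := by
  have hone : (1 : ℂ) ∉ spectrum ℂ ((M.map Complex.ofReal) ^ k) := by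
    rw [spectrum.map_pow_of_pos _ hk]
    rintro ⟨μ, hμ, hμk⟩
    have hnorm : ‖μ‖ ^ k = 1 := by
      rw [← norm_pow]
      simpa using congrArg norm hμk
    exact (pow_lt_one₀ (norm_nonneg μ) (hM μ hμ) hk.ne').ne hnorm
  rw [spectrum.notMem_iff, map_one] at hone
  have hpow : (M.map Complex.ofReal) ^ k = (M ^ k).map Complex.ofReal :=
    (map_pow Complex.ofRealHom.mapMatrix M k).symm
  have hw : (1 - (M.map Complex.ofReal) ^ k) *ᵥ (Complex.ofReal ∘ v) = 0 := by
    have hmap : Complex.ofReal ∘ ((M ^ k) *ᵥ v)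
        = (M ^ k).map Complex.ofReal *ᵥ (Complex.ofReal ∘ v) :=
      funext fun i => RingHom.map_mulVec Complex.ofRealHom (M ^ k) v i
    rw [sub_mulVec, one_mulVec, hpow, ← hmap, hv, sub_self]
  have hzero := mulVec_injective_of_isUnit hone (hw.trans (mulVec_zero _).symm)
  funext i
  simpa using congrFun hzero i

/-- If a Schur stable matrix maps every block of a stacked vector to the cyclically next one,
then the stacked vector vanishes. -/
theorem eq_zero_of_mulVec_eq_cyclicShift {n : Type*} [Fintype n] [DecidableEq n] {N : ℕ}
    {M : Matrix n n ℝ} (hM : ∀ μ ∈ spectrum ℂ (M.map Complex.ofReal), ‖μ‖ < 1)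
    {e : Fin N × n → ℝ}
    (he : ((1 : Matrix (Fin N) (Fin N) ℝ) ⊗ₖ M) *ᵥ e
      = (cyclicShift ℝ N ⊗ₖ (1 : Matrix n n ℝ)) *ᵥ e) : e = 0 := by
  funext ⟨i, a⟩
  let f : ℕ → n → ℝ := fun k b => e (⟨k % N, Nat.mod_lt _ i.pos⟩, b)
  have hstep : ∀ k, M *ᵥ f k = f (k + 1) := fun k => by
    funext b
    have h := congrFun he (⟨k % N, Nat.mod_lt _ i.pos⟩, b)
    rw [one_kronecker_mulVec_apply, cyclicShift_kronecker_one_mulVec_apply] at h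
    simpa only [f, Nat.mod_add_mod] using h
  have hiter : ∀ l k, (M ^ l) *ᵥ f k = f (k + l) := fun l => by
    induction l with
    | zero => simp
    | succ l ih => intro k; rw [pow_succ, ← mulVec_mulVec, hstep, ih, add_right_comm, add_assoc]
  have hper : (M ^ N) *ᵥ f i = f i := by
    rw [hiter]
    simp only [f, Nat.add_mod_right]
  have h := congrFun (eq_zero_of_pow_mulVec_eq_self hM i.pos hper) a
  simpa only [f, Nat.mod_eq_of_lt i.isLt, Pi.zero_apply] using h

/-- if the converged observer trajectories, the targets, and the LQR
feedback satisfy the stacked steady-state relations, and `A + BK` is Schur stable,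
then `x̂ = x̄` and the tracking error of the controlled variable is zero. -/
theorem stmt6 (N nx ny nu nr : ℕ) (hN : 0 < N) (hnx : 0 < nx) (hny : 0 < ny)
    (hnu : 0 < nu) (hnr : 0 < nr)
    (A : Matrix (Fin nx) (Fin nx) ℝ) (B : Matrix (Fin nx) (Fin nu) ℝ)
    (C : Matrix (Fin ny) (Fin nx) ℝ) (H : Matrix (Fin nr) (Fin ny) ℝ)
    (Bbar : Matrix (Fin nx) (Fin ny) ℝ) (Cbar : Matrix (Fin ny) (Fin ny) ℝ)
    (K : Matrix (Fin nu) (Fin nx) ℝ)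
    -- A + BK is Schur stable
    (hK : ∀ mu : ℂ, mu ∈ spectrum ℂ ((A + B * K).map Complex.ofReal) → ‖mu‖ < 1)
    (xhat : Fin N × Fin nx → ℝ) (u : Fin N × Fin nu → ℝ) (yf : Fin N × Fin ny → ℝ)
    (dhat : Fin N × Fin ny → ℝ) (r : Fin N × Fin nr → ℝ)
    (xbar : Fin N × Fin nx → ℝ) (ubar : Fin N × Fin nu → ℝ)
    -- (i) observer steady state
    (hobs1 : ((1 : Matrix (Fin N) (Fin N) ℝ) ⊗ₖ A
        - cyclicShift ℝ N ⊗ₖ (1 : Matrix (Fin nx) (Fin nx) ℝ)).mulVec xhat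
        + ((1 : Matrix (Fin N) (Fin N) ℝ) ⊗ₖ B).mulVec u
      = -((1 : Matrix (Fin N) (Fin N) ℝ) ⊗ₖ Bbar).mulVec dhat)
    (hobs2 : ((1 : Matrix (Fin N) (Fin N) ℝ) ⊗ₖ C).mulVec xhat
      = yf - ((1 : Matrix (Fin N) (Fin N) ℝ) ⊗ₖ Cbar).mulVec dhat)
    -- (ii) target equations
    (htar1 : ((1 : Matrix (Fin N) (Fin N) ℝ) ⊗ₖ A
        - cyclicShift ℝ N ⊗ₖ (1 : Matrix (Fin nx) (Fin nx) ℝ)).mulVec xbar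
        + ((1 : Matrix (Fin N) (Fin N) ℝ) ⊗ₖ B).mulVec ubar
      = -((1 : Matrix (Fin N) (Fin N) ℝ) ⊗ₖ Bbar).mulVec dhat)
    (htar2 : ((1 : Matrix (Fin N) (Fin N) ℝ) ⊗ₖ (H * C)).mulVec xbar
      = r - ((1 : Matrix (Fin N) (Fin N) ℝ) ⊗ₖ (H * Cbar)).mulVec dhat)
    -- (iii) LQR feedback
    (hfb : u - ubar = ((1 : Matrix (Fin N) (Fin N) ℝ) ⊗ₖ K).mulVec (xhat - xbar)) :
    xhat = xbar ∧ ((1 : Matrix (Fin N) (Fin N) ℝ) ⊗ₖ H).mulVec yf = r := by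
  have hx : xhat = xbar := by
    refine sub_eq_zero.mp (eq_zero_of_mulVec_eq_cyclicShift hK (sub_eq_zero.mp ?_))
    have h := sub_eq_zero.mpr (hobs1.trans htar1.symm)
    rw [add_sub_add_comm, ← mulVec_sub, ← mulVec_sub, hfb, mulVec_mulVec, ← mul_kronecker_mul,
      one_mul, sub_mulVec, sub_add_eq_add_sub, ← add_mulVec, ← kronecker_add] at h
    exact h
  refine ⟨hx, ?_⟩
  rw [eq_sub_iff_add_eq] at hobs2 htar2
  rw [← hobs2, ← htar2, hx, mulVec_add, mulVec_mulVec, mulVec_mulVec, ← mul_kronecker_mul,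
    ← mul_kronecker_mul, one_mul]
end

section
/- Let A ∈ ℝ^{n_x×n_x}, C ∈ ℝ^{n_y×n_x} with C having full row rank n_y, B̄ ∈ ℝ^{n_x×n_y}, C̄ ∈ ℝ^{n_y×n_y}, L_x ∈ ℝ^{n_x×n_y}, L_d ∈ ℝ^{n_y N×n_y}. Suppose the observer closed-loop matrix F := [[A + L_x C, (B̄ + L_x C̄) S_sel], [L_d C, S_d + L_d C̄ S_sel]] has spectral radius strictly less than 1 (equivalently, det([[A − λI_{n_x} + L_x C, (B̄ + L_x C̄) S_sel], [L_d C, S_d − λI_{n_y N} + L_d C̄ S_sel]]) ≠ 0 for all λ ∈ ℂ with |λ| ≥ 1). Then the controllability matrix of the pair (S_d, L_d), namely the n_y N × n_y N matrix [L_d, S_d L_d, S_d² L_d, …, S_d^{N−1} L_d], has full rank n_y N. -/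
open Matrix Kronecker

theorem cyclicShift_pow_apply {N : ℕ} (k : ℕ) (i j : Fin N) :
    (cyclicShift ℝ N ^ k) i j = if (j : ℕ) = ((i : ℕ) + k) % N then 1 else 0 := by
  induction k generalizing j with
  | zero => simp [Matrix.one_apply, Nat.mod_eq_of_lt i.isLt, Fin.ext_iff, eq_comm]
  | succ k ih =>
    have hpos : 0 < N := i.pos
    rw [pow_succ, Matrix.mul_apply,
      Finset.sum_eq_single (⟨((i : ℕ) + k) % N, Nat.mod_lt _ hpos⟩ : Fin N)]
    · rw [ih]
      simp [cyclicShift, Nat.add_assoc]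
    · intro b _ hb
      rw [ih, if_neg fun h => hb (Fin.ext h), zero_mul]
    · simp

theorem cyclicShift_pow_self (N : ℕ) : cyclicShift ℝ N ^ N = 1 := by
  ext i j
  rw [cyclicShift_pow_apply]
  simp [Matrix.one_apply, Nat.mod_eq_of_lt i.isLt, Fin.ext_iff, eq_comm]

theorem kronecker_one_pow {m n : Type*} [Fintype m] [DecidableEq m] [Fintype n] [DecidableEq n]
    (S : Matrix m m ℝ) (k : ℕ) :
    (S ⊗ₖ (1 : Matrix n n ℝ)) ^ k = (S ^ k) ⊗ₖ (1 : Matrix n n ℝ) := by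
  induction k with
  | zero => simp
  | succ k ih => rw [pow_succ, ih, ← Matrix.mul_kronecker_mul, ← pow_succ, one_mul]

/-- A left vector annihilated by `T ^ j * L` for all `j < k` evolves under the closed-loop
matrix as it does under `T`. -/
theorem vecMul_fromBlocks_pow {m n p : Type*} [Fintype m] [DecidableEq m] [Fintype n]
    [DecidableEq n] [Fintype p] (P : Matrix m m ℝ) (Q : Matrix m n ℝ) (C : Matrix p m ℝ)
    (K : Matrix p n ℝ) (T : Matrix n n ℝ) (L : Matrix n p ℝ) (v : n → ℝ) (k : ℕ)
    (h : ∀ j < k, v ᵥ* (T ^ j * L) = 0) :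
    Sum.elim (0 : m → ℝ) v ᵥ* Matrix.fromBlocks P Q (L * C) (T + L * K) ^ k =
      Sum.elim (0 : m → ℝ) (v ᵥ* T ^ k) := by
  induction k with
  | zero => simp
  | succ k ih =>
    have hk : v ᵥ* T ^ k ᵥ* L = 0 := by rw [Matrix.vecMul_vecMul]; exact h k k.lt_succ_self
    rw [pow_succ, ← Matrix.vecMul_vecMul, ih fun j hj => h j (hj.trans k.lt_succ_self),
      Matrix.vecMul_fromBlocks]
    simp only [Sum.elim_comp_inl, Sum.elim_comp_inr, Matrix.zero_vecMul, zero_add,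
      Matrix.vecMul_add, ← Matrix.vecMul_vecMul (v ᵥ* T ^ k) L, hk, add_zero, pow_succ]
    rw [Matrix.vecMul_vecMul]

/-- A real matrix one of whose positive powers fixes a nonzero left vector has a complex
eigenvalue of modulus one. -/
theorem exists_mem_spectrum_norm_eq_one {m : Type*} [Fintype m] [DecidableEq m]
    (F : Matrix m m ℝ) {k : ℕ} (hk : 0 < k) {w : m → ℝ} (hw : w ≠ 0) (h : w ᵥ* F ^ k = w) :
    ∃ mu ∈ spectrum ℂ (F.map Complex.ofReal), ‖mu‖ = 1 := by
  have hdet : (1 - F ^ k).det = 0 :=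
    Matrix.exists_vecMul_eq_zero_iff.mp ⟨w, hw, by rw [Matrix.vecMul_sub, h]; simp⟩
  have hmap : (1 - (F.map Complex.ofReal) ^ k) = Complex.ofRealHom.mapMatrix (1 - F ^ k) := by
    rw [map_sub, map_one, map_pow]; rfl
  have hone : (1 : ℂ) ∈ spectrum ℂ ((F.map Complex.ofReal) ^ k) := by
    rw [spectrum.mem_iff, map_one, hmap, Matrix.isUnit_iff_isUnit_det, ← RingHom.map_det, hdet]
    simp
  rw [spectrum.map_pow_of_pos _ hk] at hone
  obtain ⟨mu, hmu, hpow⟩ := hone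
  exact ⟨mu, hmu, Complex.norm_eq_one_of_pow_eq_one hpow hk.ne'⟩

/-- if `C` has full row rank and the observer closed-loop matrix is Schur
stable, then the controllability matrix `[L_d, S_d L_d, …, S_d^{N-1} L_d]` of the pair
`(S_d, L_d)` has full rank `n_y N`. -/
theorem stmt8 (N nx ny : ℕ) (hN : 0 < N) (hnx : 0 < nx) (hny : 0 < ny)
    (A : Matrix (Fin nx) (Fin nx) ℝ) (C : Matrix (Fin ny) (Fin nx) ℝ)
    (hC : C.rank = ny)
    (Bbar : Matrix (Fin nx) (Fin ny) ℝ) (Cbar : Matrix (Fin ny) (Fin ny) ℝ)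
    (Lx : Matrix (Fin nx) (Fin ny) ℝ) (Ld : Matrix (Fin N × Fin ny) (Fin ny) ℝ)
    -- the observer closed-loop matrix F is Schur stable
    (hF : ∀ mu : ℂ, mu ∈ spectrum ℂ
      ((Matrix.fromBlocks
        (A + Lx * C) ((Bbar + Lx * Cbar) * selMat ℝ N ny)
        (Ld * C)
        (cyclicShift ℝ N ⊗ₖ (1 : Matrix (Fin ny) (Fin ny) ℝ)
          + Ld * Cbar * selMat ℝ N ny)).map Complex.ofReal) → ‖mu‖ < 1) :
    (Matrix.of fun (p : Fin N × Fin ny) (q : Fin N × Fin ny) =>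
      ((cyclicShift ℝ N ⊗ₖ (1 : Matrix (Fin ny) (Fin ny) ℝ)) ^ (q.1 : ℕ) * Ld)
        p q.2).rank = ny * N := by
  set T := cyclicShift ℝ N ⊗ₖ (1 : Matrix (Fin ny) (Fin ny) ℝ) with hT
  set M : Matrix (Fin N × Fin ny) (Fin N × Fin ny) ℝ :=
    Matrix.of fun p q => (T ^ (q.1 : ℕ) * Ld) p q.2 with hM
  by_cases hdet : M.det = 0
  · obtain ⟨v, hv, hvM⟩ := Matrix.exists_vecMul_eq_zero_iff.mpr hdet
    have hTN : T ^ N = 1 := by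
      rw [hT, kronecker_one_pow, cyclicShift_pow_self, Matrix.one_kronecker_one]
    have hann : ∀ j < N, v ᵥ* (T ^ j * Ld) = 0 := fun j hj =>
      funext fun c => congrFun hvM (⟨j, hj⟩, c)
    have hfix := vecMul_fromBlocks_pow (A + Lx * C) ((Bbar + Lx * Cbar) * selMat ℝ N ny) C
      (Cbar * selMat ℝ N ny) T Ld v N hann
    rw [hTN, Matrix.vecMul_one, ← Matrix.mul_assoc] at hfix
    have hne : Sum.elim (0 : Fin nx → ℝ) v ≠ 0 := fun h =>
      hv (funext fun i => congrFun h (Sum.inr i))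
    obtain ⟨mu, hmu, hnorm⟩ := exists_mem_spectrum_norm_eq_one _ hN hne hfix
    exact absurd hnorm (hF mu hmu).ne
  · rw [Matrix.rank_of_isUnit M ((Matrix.isUnit_iff_isUnit_det M).mpr (isUnit_iff_ne_zero.mpr hdet))]
    simp [mul_comm]
end

section
/- Let A ∈ ℝ^{n_x×n_x}, B ∈ ℝ^{n_x×n_u}, C ∈ ℝ^{n_y×n_x}, H ∈ ℝ^{n_r×n_y}. Suppose rank [[A − λI_{n_x}, B], [HC, 0]] = n_x + n_r for every λ ∈ ℂ with λ^N = 1. Then the real N(n_x + n_r) × N(n_x + n_u) matrix [[A_N − S_x, B_N], [H_N C_N, 0]] has full row rank N(n_x + n_r); in particular, the stacked target equation (A_N − S_x) 𝐱̄ + B_N 𝐮̄ = b₁, H_N C_N 𝐱̄ = b₂ admits a solution (𝐱̄, 𝐮̄) for every right-hand side (b₁, b₂) ∈ ℝ^{N n_x} × ℝ^{N n_r}. -/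
open Matrix Kronecker

namespace Matrix

theorem rank_eq_card_iff_vecMul_injective {K m n : Type*} [Field K] [Fintype m] [Fintype n]
    {M : Matrix m n K} : M.rank = Fintype.card m ↔ Function.Injective M.vecMul := by
  rw [vecMul_injective_iff, linearIndependent_iff_card_eq_finrank_span, rank_eq_finrank_span_row,
    eq_comm, Set.finrank]

theorem mulVec_surjective_of_rank_eq_card {K m n : Type*} [Field K] [Fintype m] [Fintype n]
    {M : Matrix m n K} (h : M.rank = Fintype.card m) : Function.Surjective M.mulVec := by
  have : LinearMap.range M.mulVecLin = ⊤ :=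
    Submodule.eq_top_of_finrank_eq (by rw [Module.finrank_fintype_fun_eq_card]; exact h)
  exact LinearMap.range_eq_top.1 this

end Matrix

/-- The block generating function `∑ i, z ^ i • v i` of a stacked real vector. -/
noncomputable def stackedEval {N : ℕ} {α : Type*} (z : ℂ) (v : Fin N × α → ℝ) : α → ℂ :=
  fun a => ∑ i : Fin N, (v (i, a) : ℂ) * z ^ (i : ℕ)

theorem stackedEval_add {N : ℕ} {α : Type*} (z : ℂ) (v w : Fin N × α → ℝ) :
    stackedEval z (v + w) = stackedEval z v + stackedEval z w := by
  ext a
  simp [stackedEval, add_mul, Finset.sum_add_distrib]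

theorem stackedEval_sub {N : ℕ} {α : Type*} (z : ℂ) (v w : Fin N × α → ℝ) :
    stackedEval z (v - w) = stackedEval z v - stackedEval z w := by
  ext a
  simp [stackedEval, sub_mul, Finset.sum_sub_distrib]

theorem stackedEval_zero {N : ℕ} {α : Type*} (z : ℂ) :
    stackedEval z (0 : Fin N × α → ℝ) = 0 := by
  ext a
  simp [stackedEval]

theorem stackedEval_vecMul_kronecker {N : ℕ} {α β : Type*} [Fintype α] {z c : ℂ}
    {P : Matrix (Fin N) (Fin N) ℝ}
    (hP : ∀ i, ∑ k, (P i k : ℂ) * z ^ (k : ℕ) = c * z ^ (i : ℕ))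
    (M : Matrix α β ℝ) (v : Fin N × α → ℝ) :
    stackedEval z (v ᵥ* (P ⊗ₖ M)) = c • (stackedEval z v ᵥ* M.map Complex.ofReal) := by
  ext b
  simp only [stackedEval, vecMul, dotProduct, kroneckerMap_apply, Pi.smul_apply, smul_eq_mul,
    map_apply, Fintype.sum_prod_type, Complex.ofReal_sum, Complex.ofReal_mul, Finset.sum_mul,
    Finset.mul_sum]
  rw [Finset.sum_comm, Finset.sum_comm (s := Finset.univ (α := α))]
  refine Finset.sum_congr rfl fun i _ => ?_
  rw [Finset.sum_comm]
  refine Finset.sum_congr rfl fun a _ => ?_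
  calc _ = (v (i, a) : ℂ) * (M a b : ℂ) * ∑ k, (P i k : ℂ) * z ^ (k : ℕ) := by
        rw [Finset.mul_sum]
        exact Finset.sum_congr rfl fun k _ => by ring
    _ = _ := by rw [hP]; ring

theorem stackedEval_vecMul_one_kronecker {N : ℕ} {α β : Type*} [Fintype α] (z : ℂ)
    (M : Matrix α β ℝ) (v : Fin N × α → ℝ) :
    stackedEval z (v ᵥ* ((1 : Matrix (Fin N) (Fin N) ℝ) ⊗ₖ M)) =
      stackedEval z v ᵥ* M.map Complex.ofReal := by
  rw [stackedEval_vecMul_kronecker (c := 1) _ M v, one_smul]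
  intro i
  simp [one_apply, apply_ite Complex.ofReal]

theorem sum_cyclicShift_mul_pow {N : ℕ} {z : ℂ} (hz : z ^ N = 1) (i : Fin N) :
    ∑ k, (cyclicShift ℝ N i k : ℂ) * z ^ (k : ℕ) = z * z ^ (i : ℕ) := by
  have hi : ((i : ℕ) + 1) % N < N := Nat.mod_lt _ i.pos
  rw [Finset.sum_eq_single ⟨((i : ℕ) + 1) % N, hi⟩]
  · simp only [cyclicShift, of_apply, if_true, Complex.ofReal_one, one_mul]
    rw [← pow_succ', ← pow_eq_pow_mod _ hz]
  · intro k _ hk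
    have : (k : ℕ) ≠ ((i : ℕ) + 1) % N := fun h => hk (Fin.ext h)
    simp [cyclicShift, this]
  · simp

theorem eq_zero_of_stackedEval_eq_zero {N : ℕ} (hN : N ≠ 0) {α : Type*} {v : Fin N × α → ℝ}
    (h : ∀ z : ℂ, z ^ N = 1 → stackedEval z v = 0) : v = 0 := by
  have hζ := Complex.isPrimitiveRoot_exp N hN
  set ζ := Complex.exp (2 * Real.pi * Complex.I / N)
  have hinj : Function.Injective fun j : Fin N => ζ ^ (j : ℕ) :=
    fun i j hij => Fin.ext (hζ.pow_inj i.isLt j.isLt hij)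
  ext ⟨i, a⟩
  have key : (fun i => (v (i, a) : ℂ)) = 0 :=
    eq_zero_of_forall_index_sum_mul_pow_eq_zero hinj fun j =>
      congrFun (h (ζ ^ (j : ℕ)) (by rw [pow_right_comm, hζ.pow_eq_one, one_pow])) a
  exact Complex.ofReal_eq_zero.1 (congrFun key i)

/-- if the non-resonance rank condition holds at every `N`-th root of
unity, then the stacked target-equation matrix has full row rank `N (n_x + n_r)`;
in particular the target equations are solvable for every right-hand side. -/
theorem stmt11 (N nx ny nu nr : ℕ) (hN : 0 < N) (hnx : 0 < nx) (hny : 0 < ny)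
    (hnu : 0 < nu) (hnr : 0 < nr)
    (A : Matrix (Fin nx) (Fin nx) ℝ) (B : Matrix (Fin nx) (Fin nu) ℝ)
    (C : Matrix (Fin ny) (Fin nx) ℝ) (H : Matrix (Fin nr) (Fin ny) ℝ)
    (hcond : ∀ lam : ℂ, lam ^ N = 1 →
      (Matrix.fromBlocks
        (A.map Complex.ofReal - lam • 1) (B.map Complex.ofReal)
        ((H * C).map Complex.ofReal) (0 : Matrix (Fin nr) (Fin nu) ℂ)).rank = nx + nr) :
    (Matrix.fromBlocks
      ((1 : Matrix (Fin N) (Fin N) ℝ) ⊗ₖ A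
        - cyclicShift ℝ N ⊗ₖ (1 : Matrix (Fin nx) (Fin nx) ℝ))
      ((1 : Matrix (Fin N) (Fin N) ℝ) ⊗ₖ B)
      ((1 : Matrix (Fin N) (Fin N) ℝ) ⊗ₖ (H * C))
      (0 : Matrix (Fin N × Fin nr) (Fin N × Fin nu) ℝ)).rank = N * (nx + nr) ∧
    (∀ (b₁ : Fin N × Fin nx → ℝ) (b₂ : Fin N × Fin nr → ℝ),
      ∃ (xbar : Fin N × Fin nx → ℝ) (ubar : Fin N × Fin nu → ℝ),
        ((1 : Matrix (Fin N) (Fin N) ℝ) ⊗ₖ A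
            - cyclicShift ℝ N ⊗ₖ (1 : Matrix (Fin nx) (Fin nx) ℝ)).mulVec xbar
          + ((1 : Matrix (Fin N) (Fin N) ℝ) ⊗ₖ B).mulVec ubar = b₁ ∧
        ((1 : Matrix (Fin N) (Fin N) ℝ) ⊗ₖ (H * C)).mulVec xbar = b₂) := by
  have hrank : (Matrix.fromBlocks
      ((1 : Matrix (Fin N) (Fin N) ℝ) ⊗ₖ A
        - cyclicShift ℝ N ⊗ₖ (1 : Matrix (Fin nx) (Fin nx) ℝ))
      ((1 : Matrix (Fin N) (Fin N) ℝ) ⊗ₖ B)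
      ((1 : Matrix (Fin N) (Fin N) ℝ) ⊗ₖ (H * C))
      (0 : Matrix (Fin N × Fin nr) (Fin N × Fin nu) ℝ)).rank
      = Fintype.card (Fin N × Fin nx ⊕ Fin N × Fin nr) := by
    rw [rank_eq_card_iff_vecMul_injective, ← coe_vecMulLinear, ← LinearMap.ker_eq_bot,
      LinearMap.ker_eq_bot']
    intro w hw
    rw [vecMulLinear_apply, vecMul_fromBlocks] at hw
    have hx := congrArg (· ∘ Sum.inl) hw
    have hu := congrArg (· ∘ Sum.inr) hw
    simp only [Sum.elim_comp_inl, Sum.elim_comp_inr, vecMul_zero, add_zero, vecMul_sub,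
      Pi.zero_comp] at hx hu
    have heval (z : ℂ) (hz : z ^ N = 1) :
        stackedEval z (w ∘ Sum.inl) = 0 ∧ stackedEval z (w ∘ Sum.inr) = 0 := by
      have hinj := rank_eq_card_iff_vecMul_injective.1
        ((hcond z hz).trans (by simp [Fintype.card_sum]))
      have hx' := congrArg (stackedEval z) hx
      have hu' := congrArg (stackedEval z) hu
      rw [stackedEval_add, stackedEval_sub, stackedEval_vecMul_one_kronecker,
        stackedEval_vecMul_one_kronecker,
        stackedEval_vecMul_kronecker (sum_cyclicShift_mul_pow hz), stackedEval_zero,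
        Matrix.map_one _ Complex.ofReal_zero Complex.ofReal_one, vecMul_one] at hx'
      rw [stackedEval_vecMul_one_kronecker, stackedEval_zero] at hu'
      have h0 : Sum.elim (stackedEval z (w ∘ Sum.inl)) (stackedEval z (w ∘ Sum.inr)) = 0 := by
        apply hinj
        simp only [vecMul_fromBlocks, Sum.elim_comp_inl, Sum.elim_comp_inr, vecMul_sub,
          vecMul_smul, vecMul_one, vecMul_zero, zero_vecMul, add_zero, hx', hu']
        exact Sum.elim_zero_zero
      exact ⟨funext fun a => congrFun h0 (Sum.inl a), funext fun a => congrFun h0 (Sum.inr a)⟩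
    have h₁ := eq_zero_of_stackedEval_eq_zero hN.ne' fun z hz => (heval z hz).1
    have h₂ := eq_zero_of_stackedEval_eq_zero hN.ne' fun z hz => (heval z hz).2
    rw [← Sum.elim_comp_inl_inr w, h₁, h₂]
    exact Sum.elim_zero_zero
  refine ⟨hrank.trans (by simp [mul_add]), fun b₁ b₂ => ?_⟩
  obtain ⟨x, hx⟩ := mulVec_surjective_of_rank_eq_card hrank (Sum.elim b₁ b₂)
  rw [fromBlocks_mulVec, zero_mulVec, add_zero] at hx
  exact ⟨x ∘ Sum.inl, x ∘ Sum.inr, congrArg (· ∘ Sum.inl) hx, congrArg (· ∘ Sum.inr) hx⟩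
end
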